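/- Let n ≥ 3, 1 < p < ∞, and let Ω ⊆ ℝⁿ be a bounded connected open set. If ℝⁿ∖Ω is uniformly p-fat with constants c₀ and r₀ and for every x₀ ∈ ∂Ω and 0 < R ≤ r₀, then there exist a constant c₁ > 0 depending only on n, p, c₀, and a compact set K with x₀ ∈ K ⊆ (ℝⁿ∖Ω) ∩ B̄(x₀,R), such that K is uniformly p-fat with constants c₁ and R, i.e. cap_p(K ∩ B̄(x,r), B(x,2r)) ≥ c₁ cap_p(B̄(x,r), B(x,2r)) for all x ∈ ∂K and 0 < r ≤ R. -/

import Mathlib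

open MeasureTheory Metric
open scoped NNReal ENNReal

/-- The variational `p`-capacity of the condenser `(K, U)`: the infimum of `∫_U |∇φ|^p`
over Lipschitz functions `φ` with compact support contained in `U` with `φ ≥ 1` on `K`. -/
noncomputable def pCap (n : ℕ) (p : ℝ) (K U : Set (EuclideanSpace ℝ (Fin n))) : ℝ :=
  sInf { c : ℝ | ∃ φ : EuclideanSpace ℝ (Fin n) → ℝ, (∃ L : ℝ≥0, LipschitzWith L φ) ∧
    HasCompactSupport φ ∧ tsupport φ ⊆ U ∧ (∀ x ∈ K, 1 ≤ φ x) ∧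
    c = ∫ x in U, ‖fderiv ℝ φ x‖ ^ p }

/-- A closed set `E ⊆ ℝⁿ` is uniformly `p`-fat with constants `c₀, r₀ > 0` if
`cap_p(E ∩ B̄(x,r), B(x,2r)) ≥ c₀ · cap_p(B̄(x,r), B(x,2r))` for all `x ∈ ∂E`, `0 < r ≤ r₀`. -/
def UniformlyFat (n : ℕ) (p c₀ r₀ : ℝ) (E : Set (EuclideanSpace ℝ (Fin n))) : Prop :=
  ∀ x ∈ frontier E, ∀ r : ℝ, 0 < r → r ≤ r₀ →
    c₀ * pCap n p (closedBall x r) (ball x (2 * r)) ≤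
      pCap n p (E ∩ closedBall x r) (ball x (2 * r))

theorem LipschitzWith.enorm_rpow_le_lintegral_deriv {g : ℝ → ℝ} {L : ℝ≥0} (hg : LipschitzWith L g)
    {p : ℝ} (hp : 1 < p) {T : ℝ} (hT : 0 ≤ T) (hgT : g T = 0) :
    ‖g 0‖ₑ ^ p ≤ ENNReal.ofReal T ^ (p - 1) * ∫⁻ s in Set.Ioc 0 T, ‖deriv g s‖ₑ ^ p := by
  have hp0 : 0 < p := by linarith
  have h1 : ‖g 0‖ₑ ≤ ∫⁻ s in Set.Ioc 0 T, ‖deriv g s‖ₑ := by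
    have hac : AbsolutelyContinuousOnInterval g 0 T :=
      hg.lipschitzOnWith.absolutelyContinuousOnInterval
    have := hac.integral_deriv_eq_sub
    rw [hgT, zero_sub, intervalIntegral.integral_of_le hT] at this
    calc ‖g 0‖ₑ = ‖∫ s in Set.Ioc 0 T, deriv g s‖ₑ := by rw [this, enorm_neg]
      _ ≤ _ := enorm_integral_le_lintegral_enorm _
  have hpq := Real.HolderConjugate.conjExponent hp
  have hH := ENNReal.lintegral_mul_le_Lp_mul_Lq (volume.restrict (Set.Ioc 0 T)) hpq
    (f := fun s => ‖deriv g s‖ₑ) (g := fun _ => 1) (by fun_prop) (by fun_prop)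
  simp only [Pi.mul_apply, mul_one, ENNReal.one_rpow, lintegral_const, one_mul,
    Measure.restrict_apply_univ, Real.volume_Ioc, sub_zero] at hH
  calc ‖g 0‖ₑ ^ p ≤ ((∫⁻ s in Set.Ioc 0 T, ‖deriv g s‖ₑ ^ p) ^ (1 / p) *
        ENNReal.ofReal T ^ (1 / p.conjExponent)) ^ p := by
        gcongr; exact h1.trans hH
    _ = _ := by
      rw [ENNReal.mul_rpow_of_nonneg _ _ hp0.le, ← ENNReal.rpow_mul, ← ENNReal.rpow_mul,
        one_div_mul_cancel hp0.ne', ENNReal.rpow_one, mul_comm]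
      congr 2
      rw [Real.conjExponent]
      field_simp

section Friedrichs

variable {E : Type*} [NormedAddCommGroup E] [NormedSpace ℝ E] [FiniteDimensional ℝ E]
  [MeasurableSpace E] [BorelSpace E] (μ : Measure E) [μ.IsAddHaarMeasure]

theorem LipschitzWith.enorm_lineDeriv_le_ae {φ : E → ℝ} {L : ℝ≥0} (hφ : LipschitzWith L φ)
    {e : E} (he : ‖e‖ = 1) : ∀ᵐ z ∂μ, ‖lineDeriv ℝ φ z e‖ₑ ≤ ‖fderiv ℝ φ z‖ₑ := by
  filter_upwards [hφ.ae_differentiableAt (μ := μ)] with z hz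
  rw [hz.lineDeriv_eq_fderiv]
  have := (fderiv ℝ φ z).le_opENorm e
  have he' : ‖e‖ₑ = 1 := by rw [← ofReal_norm, he, ENNReal.ofReal_one]
  rwa [he', mul_one] at this

theorem LipschitzWith.lintegral_enorm_rpow_le_fderiv {φ : E → ℝ} {L : ℝ≥0}
    (hφ : LipschitzWith L φ) [Nontrivial E] {p : ℝ} (hp : 1 < p) {x : E} {R : ℝ} (hR : 0 < R)
    (hs : ∀ z ∉ ball x R, φ z = 0) :
    ∫⁻ z, ‖φ z‖ₑ ^ p ∂μ ≤ ENNReal.ofReal (2 * R) ^ p * ∫⁻ z, ‖fderiv ℝ φ z‖ₑ ^ p ∂μ := by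
  obtain ⟨e, he⟩ := exists_norm_eq E zero_le_one
  have hmeas : Measurable fun z => ‖lineDeriv ℝ φ z e‖ₑ ^ p :=
    ((measurable_lineDeriv hφ.continuous).enorm).pow_const p
  have hpt : ∀ z, ‖φ z‖ₑ ^ p ≤ ENNReal.ofReal (2 * R) ^ (p - 1) *
      ∫⁻ s in Set.Ioc 0 (2 * R), ‖lineDeriv ℝ φ (z + s • e) e‖ₑ ^ p := by
    intro z
    by_cases hz : z ∈ ball x R
    · have hlip : LipschitzWith (L * 1) fun s : ℝ => φ (z + s • e) := by
        refine hφ.comp (LipschitzWith.of_dist_le_mul fun a b => ?_)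
        simp [dist_eq_norm, ← sub_smul, norm_smul, he]
      have hT : φ (z + (2 * R) • e) = 0 := by
        refine hs _ fun h => ?_
        have h2 : ‖(2 * R) • e‖ = 2 * R := by
          rw [norm_smul, he, mul_one, Real.norm_of_nonneg (by positivity)]
        have h3 := dist_triangle_right (z + (2 * R) • e) z x
        rw [dist_self_add_left, h2] at h3
        rw [mem_ball] at h hz
        linarith
      have h := hlip.enorm_rpow_le_lintegral_deriv hp (by positivity) hT
      simp only [zero_smul, add_zero] at h
      refine h.trans_eq ?_
      congr 2
      ext s
      congr 2
      rw [lineDeriv]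
      have := deriv_comp_const_add (f := fun t : ℝ => φ (z + t • e)) s 0
      rw [add_zero] at this
      rw [← this]
      simp only [add_smul, add_assoc]
    · rw [hs z hz]
      simp [show 0 < p by linarith]
  calc ∫⁻ z, ‖φ z‖ₑ ^ p ∂μ
      ≤ ∫⁻ z, ENNReal.ofReal (2 * R) ^ (p - 1) *
        (∫⁻ s in Set.Ioc 0 (2 * R), ‖lineDeriv ℝ φ (z + s • e) e‖ₑ ^ p) ∂μ := lintegral_mono hpt
    _ = ENNReal.ofReal (2 * R) ^ (p - 1) *
        ∫⁻ s in Set.Ioc 0 (2 * R), (∫⁻ z, ‖lineDeriv ℝ φ (z + s • e) e‖ₑ ^ p ∂μ) := by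
      have hm : Measurable fun q : E × ℝ => ‖lineDeriv ℝ φ (q.1 + q.2 • e) e‖ₑ ^ p :=
        hmeas.comp (by fun_prop)
      rw [lintegral_const_mul _ hm.lintegral_prod_right', lintegral_lintegral_swap hm.aemeasurable]
    _ = ENNReal.ofReal (2 * R) ^ p * ∫⁻ z, ‖lineDeriv ℝ φ z e‖ₑ ^ p ∂μ := by
      have : ∀ s : ℝ, ∫⁻ z, ‖lineDeriv ℝ φ (z + s • e) e‖ₑ ^ p ∂μ =
          ∫⁻ z, ‖lineDeriv ℝ φ z e‖ₑ ^ p ∂μ := fun s =>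
        lintegral_add_right_eq_self (fun z => ‖lineDeriv ℝ φ z e‖ₑ ^ p) (s • e)
      simp only [this, lintegral_const, Measure.restrict_apply_univ, Real.volume_Ioc, sub_zero]
      have h0 : ENNReal.ofReal (2 * R) ≠ 0 := by simpa using hR
      rw [mul_comm (∫⁻ z, _ ∂μ), ← mul_assoc]
      congr 1
      nth_rewrite 2 [← ENNReal.rpow_one (ENNReal.ofReal (2 * R))]
      rw [← ENNReal.rpow_add _ _ h0 ENNReal.ofReal_ne_top, sub_add_cancel]
    _ ≤ _ := by
      refine mul_le_mul' le_rfl (lintegral_mono_ae ?_)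
      filter_upwards [hφ.enorm_lineDeriv_le_ae μ he] with z hz
      gcongr

end Friedrichs

section Energy

variable {E : Type*} [NormedAddCommGroup E] [MeasurableSpace E] [BorelSpace E]

theorem Continuous.integrable_abs_rpow (μ : Measure E) [IsFiniteMeasureOnCompacts μ] {φ : E → ℝ}
    (hφ : Continuous φ) (hc : HasCompactSupport φ) {p : ℝ} (hp : 0 < p) :
    Integrable (fun z => |φ z| ^ p) μ := by
  refine Continuous.integrable_of_hasCompactSupport ?_ ?_
  · exact hφ.abs.rpow_const fun _ => Or.inr hp.le
  · exact hc.comp_left (g := fun t : ℝ => |t| ^ p) (by simp [hp.ne'])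

variable [NormedSpace ℝ E]

theorem LipschitzWith.integrable_norm_fderiv_rpow (μ : Measure E)
    [IsFiniteMeasureOnCompacts μ] {φ : E → ℝ} {L : ℝ≥0} (hφ : LipschitzWith L φ)
    (hc : HasCompactSupport φ) {p : ℝ} (hp : 0 < p) :
    Integrable (fun z => ‖fderiv ℝ φ z‖ ^ p) μ := by
  rw [← integrableOn_iff_integrable_of_support_subset (s := tsupport φ)]
  · refine Measure.integrableOn_of_bounded (M := (L : ℝ) ^ p) hc.measure_lt_top.ne ?_ ?_
    · exact (((measurable_fderiv ℝ φ).norm).pow_const p).aestronglyMeasurable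
    · refine Filter.Eventually.of_forall fun z => ?_
      rw [Real.norm_of_nonneg (by positivity)]
      gcongr
      exact norm_fderiv_le_of_lipschitz ℝ hφ
  · intro z hz
    by_contra h
    exact hz (by simp [fderiv_of_notMem_tsupport ℝ h, hp.ne'])

theorem LipschitzWith.integral_abs_rpow_le_fderiv [FiniteDimensional ℝ E] [Nontrivial E]
    (μ : Measure E) [μ.IsAddHaarMeasure] {φ : E → ℝ} {L : ℝ≥0}
    (hφ : LipschitzWith L φ) (hc : HasCompactSupport φ) {p : ℝ} (hp : 1 < p) {x : E} {R : ℝ}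
    (hR : 0 < R) (hs : tsupport φ ⊆ ball x R) :
    ∫ z, |φ z| ^ p ∂μ ≤ (2 * R) ^ p * ∫ z, ‖fderiv ℝ φ z‖ ^ p ∂μ := by
  have hp0 : 0 < p := by linarith
  have h := hφ.lintegral_enorm_rpow_le_fderiv μ hp hR
    (fun z hz => image_eq_zero_of_notMem_tsupport fun h => hz (hs h))
  have e1 : ∫⁻ z, ‖φ z‖ₑ ^ p ∂μ = ENNReal.ofReal (∫ z, |φ z| ^ p ∂μ) := by
    rw [ofReal_integral_eq_lintegral_ofReal (hφ.continuous.integrable_abs_rpow μ hc hp0)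
      (Filter.Eventually.of_forall fun z => by positivity)]
    simp [← ENNReal.ofReal_rpow_of_nonneg, hp0.le, Real.enorm_eq_ofReal_abs]
  have e2 : ∫⁻ z, ‖fderiv ℝ φ z‖ₑ ^ p ∂μ = ENNReal.ofReal (∫ z, ‖fderiv ℝ φ z‖ ^ p ∂μ) := by
    rw [ofReal_integral_eq_lintegral_ofReal (hφ.integrable_norm_fderiv_rpow μ hc hp0)
      (Filter.Eventually.of_forall fun z => by positivity)]
    simp [← ENNReal.ofReal_rpow_of_nonneg, hp0.le, ofReal_norm]
  rw [e1, e2, ENNReal.ofReal_rpow_of_nonneg (by positivity) hp0.le,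
    ← ENNReal.ofReal_mul (by positivity)] at h
  exact (ENNReal.ofReal_le_ofReal_iff
    (mul_nonneg (by positivity) (integral_nonneg fun z => by positivity))).1 h

end Energy

section Cutoff

variable {X : Type*} [PseudoMetricSpace X]

/-- A radial cutoff equal to `1` on `closedBall y ρ` and vanishing outside
`closedBall y (3 / 2 * ρ)`. -/
noncomputable def ballCutoff (y : X) (ρ : ℝ) (z : X) : ℝ :=
  max 0 (min 1 (3 - 2 / ρ * dist z y))

theorem ballCutoff_nonneg (y : X) (ρ : ℝ) (z : X) : 0 ≤ ballCutoff y ρ z := le_max_left _ _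

theorem ballCutoff_le_one (y : X) (ρ : ℝ) (z : X) : ballCutoff y ρ z ≤ 1 :=
  max_le zero_le_one (min_le_left _ _)

theorem ballCutoff_eq_one {y : X} {ρ : ℝ} (hρ : 0 < ρ) {z : X} (hz : z ∈ closedBall y ρ) :
    ballCutoff y ρ z = 1 := by
  have h : 2 / ρ * dist z y ≤ 2 / ρ * ρ := by gcongr; exact hz
  rw [div_mul_cancel₀ _ hρ.ne'] at h
  rw [ballCutoff, min_eq_left (by linarith), max_eq_right zero_le_one]

theorem tsupport_ballCutoff_subset (y : X) {ρ : ℝ} (hρ : 0 < ρ) :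
    tsupport (ballCutoff y ρ) ⊆ closedBall y (3 / 2 * ρ) := by
  refine closure_minimal (fun z hz => ?_) isClosed_closedBall
  by_contra h
  rw [mem_closedBall, not_le] at h
  have h' : 2 / ρ * (3 / 2 * ρ) ≤ 2 / ρ * dist z y := by gcongr
  have : 2 / ρ * (3 / 2 * ρ) = 3 := by field_simp
  exact hz (max_eq_left ((min_le_right _ _).trans (by linarith)))

theorem lipschitzWith_ballCutoff (y : X) {ρ : ℝ} (hρ : 0 < ρ) :
    LipschitzWith (Real.toNNReal (2 / ρ)) (ballCutoff y ρ) := by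
  refine ((LipschitzWith.of_dist_le_mul fun a b => ?_).const_min 1).const_max 0
  rw [Real.coe_toNNReal _ (by positivity), Real.dist_eq]
  have : 3 - 2 / ρ * dist a y - (3 - 2 / ρ * dist b y) = 2 / ρ * (dist b y - dist a y) := by ring
  rw [this, abs_mul, abs_of_pos (by positivity : 0 < 2 / ρ)]
  gcongr
  rw [dist_comm a b]
  exact abs_dist_sub_le b a y

end Cutoff

section Capacity

variable {n : ℕ} {p : ℝ}

theorem setIntegral_fderiv_rpow_eq_integral {φ : EuclideanSpace ℝ (Fin n) → ℝ}
    {U : Set (EuclideanSpace ℝ (Fin n))} (hU : tsupport φ ⊆ U) (hp : 0 < p) :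
    ∫ x in U, ‖fderiv ℝ φ x‖ ^ p = ∫ x, ‖fderiv ℝ φ x‖ ^ p :=
  setIntegral_eq_integral_of_forall_compl_eq_zero fun x hx => by
    simp [fderiv_of_notMem_tsupport ℝ fun h => hx (hU h), hp.ne']

theorem pCap_le {φ : EuclideanSpace ℝ (Fin n) → ℝ} {K U : Set (EuclideanSpace ℝ (Fin n))}
    (hp : 0 < p) {L : ℝ≥0} (hφ : LipschitzWith L φ)
    (hc : HasCompactSupport φ) (hU : tsupport φ ⊆ U) (hK : ∀ x ∈ K, 1 ≤ φ x) :
    pCap n p K U ≤ ∫ x, ‖fderiv ℝ φ x‖ ^ p := by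
  rw [← setIntegral_fderiv_rpow_eq_integral hU hp]
  refine csInf_le ⟨0, ?_⟩ ⟨φ, ⟨L, hφ⟩, hc, hU, hK, rfl⟩
  rintro c ⟨ψ, -, -, -, -, rfl⟩
  exact integral_nonneg fun z => by positivity

theorem hasCompactSupport_ballCutoff (y : EuclideanSpace ℝ (Fin n)) {ρ : ℝ} (hρ : 0 < ρ) :
    HasCompactSupport (ballCutoff y ρ) :=
  (isCompact_closedBall y (3 / 2 * ρ)).of_isClosed_subset (isClosed_tsupport _)
    (tsupport_ballCutoff_subset y hρ)

theorem le_pCap {K : Set (EuclideanSpace ℝ (Fin n))} {x : EuclideanSpace ℝ (Fin n)} {r c : ℝ}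
    (hp : 0 < p) (hr : 0 < r) (hK : K ⊆ closedBall x r)
    (h : ∀ (φ : EuclideanSpace ℝ (Fin n) → ℝ) (L : ℝ≥0), LipschitzWith L φ → HasCompactSupport φ →
      tsupport φ ⊆ ball x (2 * r) → (∀ x ∈ K, 1 ≤ φ x) → c ≤ ∫ x, ‖fderiv ℝ φ x‖ ^ p) :
    c ≤ pCap n p K (ball x (2 * r)) := by
  refine le_csInf ⟨_, ballCutoff x r, ⟨_, lipschitzWith_ballCutoff x hr⟩,
    hasCompactSupport_ballCutoff x hr, ?_, fun z hz => (ballCutoff_eq_one hr (hK hz)).ge, rfl⟩ ?_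
  · exact (tsupport_ballCutoff_subset x hr).trans (closedBall_subset_ball (by linarith))
  · rintro c ⟨φ, ⟨L, hφ⟩, hc, hU, hK', rfl⟩
    rw [setIntegral_fderiv_rpow_eq_integral hU hp]
    exact h φ L hφ hc hU hK'

theorem pCap_nonneg {K U : Set (EuclideanSpace ℝ (Fin n))} : 0 ≤ pCap n p K U := by
  refine Real.sInf_nonneg ?_
  rintro c ⟨ψ, -, -, -, -, rfl⟩
  exact integral_nonneg fun z => by positivity

theorem pCap_mono {K K' : Set (EuclideanSpace ℝ (Fin n))} {x y : EuclideanSpace ℝ (Fin n)}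
    {r r' : ℝ} (hp : 0 < p) (hr : 0 < r) (hK : K' ⊆ closedBall x r) (hKK : K ⊆ K')
    (hb : ball x (2 * r) ⊆ ball y r') :
    pCap n p K (ball y r') ≤ pCap n p K' (ball x (2 * r)) :=
  le_pCap hp hr hK fun _ _ hφ hc hU h1 =>
    pCap_le hp hφ hc (hU.trans hb) fun z hz => h1 z (hKK hz)

theorem pCap_closedBall_le (hp : 0 < p) (x : EuclideanSpace ℝ (Fin n)) {r : ℝ} (hr : 0 < r) :
    pCap n p (closedBall x r) (ball x (2 * r)) ≤
      (2 / r) ^ p * ((2 * r) ^ n * volume.real (ball (0 : EuclideanSpace ℝ (Fin n)) 1)) := by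
  have hU : tsupport (ballCutoff x r) ⊆ closedBall x (2 * r) :=
    (tsupport_ballCutoff_subset x hr).trans (closedBall_subset_closedBall (by linarith))
  refine (pCap_le hp (lipschitzWith_ballCutoff x hr) (hasCompactSupport_ballCutoff x hr)
    ((tsupport_ballCutoff_subset x hr).trans (closedBall_subset_ball (by linarith)))
    fun z hz => (ballCutoff_eq_one hr hz).ge).trans ?_
  rw [← setIntegral_fderiv_rpow_eq_integral hU hp]
  have h := norm_setIntegral_le_of_norm_le_const (μ := volume) (s := closedBall x (2 * r))
    (f := fun z => ‖fderiv ℝ (ballCutoff x r) z‖ ^ p) (C := (2 / r) ^ p)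
    measure_closedBall_lt_top fun z _ => by
      rw [Real.norm_of_nonneg (by positivity)]
      gcongr
      have := norm_fderiv_le_of_lipschitz ℝ (x₀ := z) (lipschitzWith_ballCutoff x hr)
      rwa [Real.coe_toNNReal _ (by positivity)] at this
  have hv := Measure.addHaar_real_closedBall (volume : Measure (EuclideanSpace ℝ (Fin n))) x
    (r := 2 * r) (by positivity)
  rw [hv, finrank_euclideanSpace_fin] at h
  exact (le_abs_self _).trans h

theorem le_pCap_closedBall (hn : n ≠ 0) (hp : 1 < p) (x : EuclideanSpace ℝ (Fin n)) {r : ℝ}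
    (hr : 0 < r) :
    (4 * r) ^ (-p) * (r ^ n * volume.real (ball (0 : EuclideanSpace ℝ (Fin n)) 1)) ≤
      pCap n p (closedBall x r) (ball x (2 * r)) := by
  have hp0 : 0 < p := by linarith
  have : Nonempty (Fin n) := ⟨⟨0, Nat.pos_of_ne_zero hn⟩⟩
  refine le_pCap hp0 hr le_rfl fun φ L hφ hc hU h1 => ?_
  have hF := hφ.integral_abs_rpow_le_fderiv volume hc hp (by positivity) hU
  have hv := Measure.addHaar_real_closedBall (volume : Measure (EuclideanSpace ℝ (Fin n))) x hr.le
  rw [finrank_euclideanSpace_fin] at hv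
  have hint := hφ.continuous.integrable_abs_rpow volume hc hp0
  have h2 : volume.real (closedBall x r) ≤ ∫ z, |φ z| ^ p := by
    refine le_trans ?_ (setIntegral_le_integral (s := closedBall x r) hint
      (Filter.Eventually.of_forall fun z => by positivity))
    have := setIntegral_mono_on (μ := volume) (s := closedBall x r) (f := fun _ => (1 : ℝ))
      (g := fun z => |φ z| ^ p) (by simp [measure_closedBall_lt_top]) hint.integrableOn
      measurableSet_closedBall fun z hz => Real.one_le_rpow ((h1 z hz).trans (le_abs_self _)) hp0.le
    simpa using this
  rw [← hv, Real.rpow_neg (by positivity), inv_mul_le_iff₀ (by positivity)]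
  refine h2.trans (hF.trans_eq ?_)
  ring_nf

end Capacity

section Comparison

variable {n : ℕ} {p : ℝ}

theorem Real.add_rpow_le_two_rpow_mul {a b : ℝ} (ha : 0 ≤ a) (hb : 0 ≤ b) (hp : 0 ≤ p) :
    (a + b) ^ p ≤ 2 ^ p * (a ^ p + b ^ p) := by
  have key : ∀ {s t : ℝ}, 0 ≤ s → s ≤ t → (s + t) ^ p ≤ 2 ^ p * (s ^ p + t ^ p) := by
    intro s t hs hst
    have ht := hs.trans hst
    calc (s + t) ^ p ≤ (2 * t) ^ p := by gcongr; linarith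
      _ = 2 ^ p * t ^ p := Real.mul_rpow zero_le_two ht
      _ ≤ 2 ^ p * (s ^ p + t ^ p) := by
        gcongr
        linarith [Real.rpow_nonneg hs p]
  rcases le_total a b with h | h
  · exact key ha h
  · rw [add_comm a, add_comm (a ^ p)]
    exact key hb h

theorem LipschitzWith.mul_of_bounded {X : Type*} [PseudoMetricSpace X] {f g : X → ℝ}
    {Kf Kg Mf Mg : ℝ≥0} (hf : LipschitzWith Kf f) (hg : LipschitzWith Kg g)
    (hMf : ∀ x, |f x| ≤ Mf) (hMg : ∀ x, |g x| ≤ Mg) :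
    LipschitzWith (Mf * Kg + Mg * Kf) fun x => f x * g x := by
  refine LipschitzWith.of_dist_le_mul fun a b => ?_
  have hf' := hf.dist_le_mul a b
  have hg' := hg.dist_le_mul a b
  rw [Real.dist_eq] at *
  have h : f a * g a - f b * g b = f a * (g a - g b) + g b * (f a - f b) := by ring
  calc |f a * g a - f b * g b| ≤ |f a| * |g a - g b| + |g b| * |f a - f b| := by
        rw [h, ← abs_mul, ← abs_mul]
        exact abs_add_le _ _
    _ ≤ Mf * (Kg * dist a b) + Mg * (Kf * dist a b) := by
        gcongr
        · exact hMf a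
        · exact hMg b
    _ = _ := by push_cast; ring

theorem pCap_le_mul_pCap (hn : n ≠ 0) (hp : 1 < p) {F : Set (EuclideanSpace ℝ (Fin n))}
    {x y : EuclideanSpace ℝ (Fin n)} {r ρ : ℝ} (hr : 0 < r) (hρ : 0 < ρ)
    (hFx : F ⊆ closedBall x r) (hFy : F ⊆ closedBall y ρ) :
    pCap n p F (ball y (2 * ρ)) ≤
      2 ^ p * ((8 * (r / ρ)) ^ p + 1) * pCap n p F (ball x (2 * r)) := by
  have hp0 : 0 < p := by linarith
  have : Nonempty (Fin n) := ⟨⟨0, Nat.pos_of_ne_zero hn⟩⟩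
  rw [← div_le_iff₀' (by positivity)]
  refine le_pCap hp0 hr hFx fun φ L hφ hc hU h1 => ?_
  rw [div_le_iff₀' (by positivity)]
  have hη := lipschitzWith_ballCutoff y hρ
  obtain ⟨M, hM⟩ := hc.exists_bound_of_continuous hφ.continuous
  have hψ := hφ.mul_of_bounded hη (Mf := M.toNNReal) (Mg := 1)
    (fun z => (hM z).trans (Real.le_coe_toNNReal M))
    (fun z => by simpa [abs_of_nonneg (ballCutoff_nonneg y ρ z)] using ballCutoff_le_one y ρ z)
  have hψs : tsupport (fun z => φ z * ballCutoff y ρ z) ⊆ ball y (2 * ρ) :=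
    (tsupport_mul_subset_right (f := φ)).trans <|
      (tsupport_ballCutoff_subset y hρ).trans (closedBall_subset_ball (by linarith))
  refine (pCap_le hp0 hψ hc.mul_right hψs fun z hz => ?_).trans ?_
  · rw [ballCutoff_eq_one hρ (hFy hz), mul_one]
    exact h1 z hz
  have hpt : ∀ᵐ z, ‖fderiv ℝ (fun z => φ z * ballCutoff y ρ z) z‖ ^ p ≤
      2 ^ p * ((2 / ρ) ^ p * |φ z| ^ p + ‖fderiv ℝ φ z‖ ^ p) := by
    filter_upwards [hφ.ae_differentiableAt, hη.ae_differentiableAt] with z hz1 hz2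
    rw [fderiv_fun_mul hz1 hz2, ← Real.mul_rpow (by positivity) (by positivity)]
    refine le_trans ?_
      (Real.add_rpow_le_two_rpow_mul (by positivity) (by positivity) hp0.le)
    gcongr
    refine (norm_add_le _ _).trans ?_
    rw [norm_smul, norm_smul, Real.norm_eq_abs, Real.norm_of_nonneg (ballCutoff_nonneg y ρ z),
      mul_comm |φ z|]
    have h2 := norm_fderiv_le_of_lipschitz ℝ (x₀ := z) hη
    rw [Real.coe_toNNReal _ (by positivity)] at h2
    gcongr
    exact mul_le_of_le_one_left (norm_nonneg _) (ballCutoff_le_one y ρ z)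
  have hi1 := hφ.continuous.integrable_abs_rpow volume hc hp0
  have hi2 := hφ.integrable_norm_fderiv_rpow volume hc hp0
  calc ∫ z, ‖fderiv ℝ (fun z => φ z * ballCutoff y ρ z) z‖ ^ p
      ≤ ∫ z, 2 ^ p * ((2 / ρ) ^ p * |φ z| ^ p + ‖fderiv ℝ φ z‖ ^ p) :=
        integral_mono_ae (hψ.integrable_norm_fderiv_rpow volume hc.mul_right hp0)
          (((hi1.const_mul _).add hi2).const_mul _) hpt
    _ = 2 ^ p * ((2 / ρ) ^ p * (∫ z, |φ z| ^ p) + ∫ z, ‖fderiv ℝ φ z‖ ^ p) := by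
        rw [integral_const_mul, integral_add (hi1.const_mul _) hi2, integral_const_mul]
    _ ≤ 2 ^ p * ((2 / ρ) ^ p * ((2 * (2 * r)) ^ p * ∫ z, ‖fderiv ℝ φ z‖ ^ p) +
          ∫ z, ‖fderiv ℝ φ z‖ ^ p) := by
        gcongr
        exact hφ.integral_abs_rpow_le_fderiv volume hc hp (by positivity) hU
    _ = _ := by
        rw [← mul_assoc ((2 / ρ) ^ p), ← Real.mul_rpow (by positivity) (by positivity),
          show 2 / ρ * (2 * (2 * r)) = 8 * (r / ρ) by ring]
        ring

theorem UniformlyFat.exists_near_of_mem {c₀ r₀ : ℝ} {E : Set (EuclideanSpace ℝ (Fin n))}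
    (hE : UniformlyFat n p c₀ r₀ E) {x : EuclideanSpace ℝ (Fin n)} (hx : x ∈ E) {r : ℝ}
    (hr : 0 < r) (hr₀ : r ≤ r₀) :
    ∃ y, dist x y ≤ r ∧ min c₀ 1 * pCap n p (closedBall y r) (ball y (2 * r)) ≤
      pCap n p (E ∩ closedBall y r) (ball y (2 * r)) := by
  by_cases h : closedBall x r ⊆ E
  · refine ⟨x, by simpa using hr.le, ?_⟩
    rw [Set.inter_eq_right.2 h]
    exact mul_le_of_le_one_left pCap_nonneg (min_le_right _ _)
  · obtain ⟨z, hz, hzE⟩ := Set.not_subset.1 h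
    obtain ⟨y, hy, hxy⟩ := exists_mem_frontier_infDist_compl_eq_dist hx
      (fun hu : E = Set.univ => hzE (hu ▸ Set.mem_univ z))
    refine ⟨y, ?_, le_trans ?_ (hE y hy r hr hr₀)⟩
    · rw [← hxy]
      exact (infDist_le_dist_of_mem hzE).trans (by rwa [dist_comm])
    · exact mul_le_mul_of_nonneg_right (min_le_left _ _) pCap_nonneg

end Comparison

section DyadicChain

variable {X : Type*} [PseudoMetricSpace X]

/-- Points of `E` reachable from `x₀` by `k` jumps inside `E` of lengths at most
`R / 2, R / 4, …, R / 2 ^ k`. -/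
def dyadicChain (E : Set X) (x₀ : X) (R : ℝ) : ℕ → Set X
  | 0 => {x₀}
  | k + 1 => {x | x ∈ E ∧ ∃ y ∈ dyadicChain E x₀ R k, dist x y ≤ R / 2 ^ (k + 1)}

variable {E : Set X} {x₀ : X} {R : ℝ}

theorem dyadicChain_subset (hx₀ : x₀ ∈ E) : ∀ k, dyadicChain E x₀ R k ⊆ E
  | 0 => by simpa [dyadicChain] using hx₀
  | _ + 1 => fun _ hx => hx.1

theorem exists_mem_dyadicChain_dist_le {j m : ℕ} (hjm : j ≤ m) {x : X}
    (hx : x ∈ dyadicChain E x₀ R m) :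
    ∃ y ∈ dyadicChain E x₀ R j, dist x y ≤ R / 2 ^ j - R / 2 ^ m := by
  induction m, hjm using Nat.le_induction generalizing x with
  | base => exact ⟨x, hx, by simp⟩
  | succ m _ ih =>
    obtain ⟨-, y, hy, hxy⟩ := hx
    obtain ⟨z, hz, hyz⟩ := ih hy
    refine ⟨z, hz, (dist_triangle x y z).trans ?_⟩
    have : R / 2 ^ m = 2 * (R / 2 ^ (m + 1)) := by field_simp; ring
    linarith

theorem inter_closedBall_subset_dyadicChain {k : ℕ} {y : X} (hy : y ∈ dyadicChain E x₀ R k) :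
    E ∩ closedBall y (R / 2 ^ (k + 1)) ⊆ dyadicChain E x₀ R (k + 1) :=
  fun _ hx => ⟨hx.1, y, hy, hx.2⟩

theorem exists_near_inter_closedBall_subset_dyadicChain (hR : 0 < R) {m : ℕ} {x : X}
    (hx : x ∈ dyadicChain E x₀ R m) {s : ℝ} (hs : 0 < s) (hsR : s ≤ R) :
    ∃ k, ∃ y ∈ dyadicChain E x₀ R k, dist x y ≤ s / 2 ∧
      E ∩ closedBall y (s / 8) ⊆ dyadicChain E x₀ R (k + 1) := by
  have hhalf : ∀ k : ℕ, R / 2 ^ k = 2 * (R / 2 ^ (k + 1)) := fun k => by field_simp; ring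
  have hex : ∃ j : ℕ, R / 2 ^ j ≤ s / 2 := by
    obtain ⟨j, hj⟩ := exists_pow_lt_of_lt_one (show 0 < s / 2 / R by positivity)
      (by norm_num : (1 / 2 : ℝ) < 1)
    refine ⟨j, ?_⟩
    rw [lt_div_iff₀ hR, one_div, inv_pow] at hj
    rw [div_eq_inv_mul]
    exact hj.le
  classical
  have hmin : ∀ i < Nat.find hex, s / 2 < R / 2 ^ i := fun i hi => not_le.1 (Nat.find_min hex hi)
  have hj := Nat.find_spec hex
  generalize Nat.find hex = j at hmin hj
  rcases le_or_gt j m with hjm | hjm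
  · obtain ⟨y, hy, hxy⟩ := exists_mem_dyadicChain_dist_le hjm hx
    have hpos : 0 < R / 2 ^ m := by positivity
    refine ⟨j, y, hy, by linarith, ?_⟩
    refine subset_trans ?_ (inter_closedBall_subset_dyadicChain hy)
    refine Set.inter_subset_inter_right _ (closedBall_subset_closedBall ?_)
    cases j with
    | zero => rw [pow_zero, div_one] at hj; linarith
    | succ i =>
      have h1 := hmin i (Nat.lt_succ_self i)
      linarith [hhalf i, hhalf (i + 1)]
  · refine ⟨m, x, hx, by rw [dist_self]; positivity, ?_⟩
    refine subset_trans ?_ (inter_closedBall_subset_dyadicChain hx)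
    refine Set.inter_subset_inter_right _ (closedBall_subset_closedBall ?_)
    linarith [hmin m hjm, hhalf m]

theorem exists_isClosed_subset_inter_closedBall (hE : IsClosed E) (hx₀ : x₀ ∈ E) (hR : 0 < R) :
    ∃ K : Set X, IsClosed K ∧ x₀ ∈ K ∧ K ⊆ E ∩ closedBall x₀ R ∧
      ∀ x ∈ K, ∀ r, 0 < r → r ≤ R →
        ∃ y ∈ E, dist x y ≤ 3 / 4 * r ∧ E ∩ closedBall y (r / 16) ⊆ K := by
  refine ⟨closure (⋃ k, dyadicChain E x₀ R k), isClosed_closure,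
    subset_closure (Set.mem_iUnion.2 ⟨0, rfl⟩), ?_, fun x hx r hr hrR => ?_⟩
  · refine closure_minimal (Set.iUnion_subset fun k x hx => ⟨dyadicChain_subset hx₀ k hx, ?_⟩)
      (hE.inter isClosed_closedBall)
    obtain ⟨y, rfl, hxy⟩ := exists_mem_dyadicChain_dist_le (Nat.zero_le k) hx
    have : 0 < R / 2 ^ k := by positivity
    rw [mem_closedBall]
    rw [pow_zero, div_one] at hxy
    linarith
  · obtain ⟨x', hx', hxx'⟩ := Metric.mem_closure_iff.1 hx (r / 2) (by positivity)
    obtain ⟨m, hm⟩ := Set.mem_iUnion.1 hx'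
    obtain ⟨k, y, hy, hxy, hyK⟩ :=
      exists_near_inter_closedBall_subset_dyadicChain hR hm (half_pos hr) (by linarith)
    refine ⟨y, dyadicChain_subset hx₀ k hy, by linarith [dist_triangle x x' y], ?_⟩
    rw [show r / 16 = r / 2 / 8 by ring]
    exact hyK.trans ((Set.subset_iUnion _ (k + 1)).trans subset_closure)

end DyadicChain

theorem pCap_closedBall_le_mul_pCap_closedBall {n : ℕ} {p : ℝ} (hn : n ≠ 0) (hp : 1 < p)
    (x y : EuclideanSpace ℝ (Fin n)) {r : ℝ} (hr : 0 < r) :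
    pCap n p (closedBall x r) (ball x (2 * r)) ≤
      64 ^ n * pCap n p (closedBall y (r / 32)) (ball y (2 * (r / 32))) := by
  have hp0 : 0 < p := by linarith
  have h1 := pCap_closedBall_le hp0 x hr
  have h2 := le_pCap_closedBall hn hp y (show 0 < r / 32 by positivity)
  refine h1.trans (le_trans ?_ (mul_le_mul_of_nonneg_left h2 (by positivity)))
  have e1 : (4 * (r / 32)) ^ (-p) = (8 / r) ^ p := by
    rw [Real.rpow_neg (by positivity), ← Real.inv_rpow (by positivity)]
    congr 1
    field_simp
    norm_num
  have e2 : (2 * r) ^ n = 64 ^ n * (r / 32) ^ n := by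
    rw [← mul_pow]
    congr 1
    ring
  rw [e1, e2]
  calc (2 / r) ^ p * (64 ^ n * (r / 32) ^ n * volume.real (ball (0 : EuclideanSpace ℝ (Fin n)) 1))
      ≤ (8 / r) ^ p *
          (64 ^ n * (r / 32) ^ n * volume.real (ball (0 : EuclideanSpace ℝ (Fin n)) 1)) := by
        gcongr
        norm_num
    _ = _ := by ring

/-- (From the proof of Theorem 3.3, Euclidean case.) If `ℝⁿ∖Ω` is uniformly `p`-fat with
constants `c₀, r₀`, then for every `x₀ ∈ ∂Ω` and `0 < R ≤ r₀` there is a compact set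
`K` with `x₀ ∈ K ⊆ (ℝⁿ∖Ω) ∩ B̄(x₀,R)` which is uniformly `p`-fat with constants `c₁, R`,
where `c₁ > 0` depends only on `n`, `p` and `c₀`. -/
theorem fat_compact_subset (n : ℕ) (hn : 3 ≤ n) (p c₀ : ℝ) (hp : 1 < p) (hc₀ : 0 < c₀) :
    ∃ c₁ : ℝ, 0 < c₁ ∧
      ∀ (Ω : Set (EuclideanSpace ℝ (Fin n))) (r₀ : ℝ), 0 < r₀ →
        Bornology.IsBounded Ω → IsConnected Ω → IsOpen Ω →
        UniformlyFat n p c₀ r₀ Ωᶜ →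
        ∀ x₀ ∈ frontier Ω, ∀ R : ℝ, 0 < R → R ≤ r₀ →
          ∃ K : Set (EuclideanSpace ℝ (Fin n)), IsCompact K ∧ x₀ ∈ K ∧
            K ⊆ Ωᶜ ∩ closedBall x₀ R ∧ UniformlyFat n p c₁ R K := by
  have hn0 : n ≠ 0 := by lia
  have hp0 : 0 < p := by linarith
  set A : ℝ := 2 ^ p * ((8 * 32) ^ p + 1) with hA
  have hA0 : 0 < A := by positivity
  have hm : 0 < min c₀ 1 := lt_min hc₀ one_pos
  refine ⟨min c₀ 1 / (A * 64 ^ n), by positivity, ?_⟩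
  intro Ω r₀ _ _ _ hΩ hfat x₀ hx₀ R hR hRr₀
  have hx₀Ω : x₀ ∈ Ωᶜ := (hΩ.frontier_eq ▸ hx₀).2
  obtain ⟨K, hKc, hx₀K, hK, hfull⟩ :=
    exists_isClosed_subset_inter_closedBall hΩ.isClosed_compl hx₀Ω hR
  refine ⟨K, (isCompact_closedBall x₀ R).of_isClosed_subset hKc
    (hK.trans Set.inter_subset_right), hx₀K, hK, fun x hx r hr hrR => ?_⟩
  obtain ⟨y, hyE, hxy, hyK⟩ := hfull x (hKc.frontier_subset hx) r hr hrR
  obtain ⟨z, hyz, hz⟩ := hfat.exists_near_of_mem hyE (r := r / 32) (by positivity) (by linarith)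
  have hF : Ωᶜ ∩ closedBall z (r / 32) ⊆ K ∩ closedBall x r := by
    rintro w ⟨hw, hwz⟩
    rw [mem_closedBall] at hwz
    have h1 := dist_triangle w z y
    have h2 := dist_triangle w y x
    rw [dist_comm z y] at h1
    rw [dist_comm y x] at h2
    refine ⟨hyK ⟨hw, ?_⟩, ?_⟩ <;> rw [mem_closedBall] <;> linarith
  have hcomp := pCap_le_mul_pCap hn0 hp hr (show 0 < r / 32 by positivity)
    (hF.trans Set.inter_subset_right) Set.inter_subset_right
  rw [show r / (r / 32) = 32 by field_simp, ← hA] at hcomp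
  have hmono := pCap_mono hp0 hr (Set.inter_subset_right (s := K)) hF le_rfl
  have hball := pCap_closedBall_le_mul_pCap_closedBall hn0 hp x z hr
  calc min c₀ 1 / (A * 64 ^ n) * pCap n p (closedBall x r) (ball x (2 * r))
      ≤ min c₀ 1 / (A * 64 ^ n) *
        (64 ^ n * pCap n p (closedBall z (r / 32)) (ball z (2 * (r / 32)))) := by gcongr
    _ = A⁻¹ * (min c₀ 1 * pCap n p (closedBall z (r / 32)) (ball z (2 * (r / 32)))) := by
        field_simp
    _ ≤ A⁻¹ * (A * pCap n p (K ∩ closedBall x r) (ball x (2 * r))) := by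
        refine mul_le_mul_of_nonneg_left (hz.trans (hcomp.trans ?_)) (by positivity)
        gcongr
    _ = _ := inv_mul_cancel_left₀ hA0.ne' _
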